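/- arXiv:2602.08330 — 2 statements merged into one kernel-verified Lean document; each statement's English description precedes it below -/
import Mathlib

section
/- Let $M^n$, $n \geq 3$, be an $n$-dimensional submanifold of an $m$-dimensional, $m \geq 4$, Riemannian manifold of quasi-constant curvature $(\widetilde{M}^m, \widetilde{g})$ with associated functions $p, q$ and distinguished unit vector field $V$. Then $\rho + \rho_N \leq \Vert H \Vert^2 + p + \frac{2q}{n}\Vert V^T \Vert^2$, where $V^T$ is the tangential component of $V$ along $M^n$. -/
open Finset Matrix

/-- Kronecker delta (the components of the metric in an orthonormal frame). -/
noncomputable def kdelta {k : ℕ} (a b : Fin k) : ℝ := if a = b then 1 else 0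

/-- The scalar curvature `tau = sum_{i<j} R(e_i, e_j, e_j, e_i)` computed from the
components of the curvature tensor in an orthonormal frame. -/
noncomputable def scalarCurv {n : ℕ} (R : Fin n → Fin n → Fin n → Fin n → ℝ) : ℝ :=
  ∑ i : Fin n, ∑ j : Fin n, if i < j then R i j j i else 0

/-- The normalized scalar curvature `rho = 2 tau / (n (n - 1))`. -/
noncomputable def normScalarCurv {n : ℕ} (R : Fin n → Fin n → Fin n → Fin n → ℝ) : ℝ :=
  2 * scalarCurv R / ((n : ℝ) * ((n : ℝ) - 1))

/-- The normal scalar curvature `K_N = -(1/4) sum_{r,s} trace ([A_r, A_s]^2)` computed from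
the shape operators (given as symmetric matrices in an orthonormal tangent frame). -/
noncomputable def KN {n p : ℕ} (A : Fin p → Matrix (Fin n) (Fin n) ℝ) : ℝ :=
  -(1 / 4) * ∑ r : Fin p, ∑ s : Fin p,
    Matrix.trace ((A r * A s - A s * A r) * (A r * A s - A s * A r))

/-- The normalized normal scalar curvature `rho_N = (2/(n(n-1))) sqrt(K_N)`. -/
noncomputable def rhoN {n p : ℕ} (A : Fin p → Matrix (Fin n) (Fin n) ℝ) : ℝ :=
  2 / ((n : ℝ) * ((n : ℝ) - 1)) * Real.sqrt (KN A)

/-- The squared mean curvature `|H|^2 = sum_r ((1/n) trace A_r)^2` computed from the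
components of the second fundamental form in adapted orthonormal frames. -/
noncomputable def meanCurvSq {n p : ℕ} (A : Fin p → Matrix (Fin n) (Fin n) ℝ) : ℝ :=
  ∑ r : Fin p, ((1 / (n : ℝ)) * ∑ i : Fin n, A r i i) ^ 2

/-- The normalized normal scalar curvature
`rho^perp = (2/(n(n-1))) sqrt( sum_{i<j} sum_{r<s} (Rperp(e_i,e_j,v_r,v_s))^2 )`
computed from the components of the normal curvature tensor. -/
noncomputable def rhoPerp {n p : ℕ} (Rp : Fin n → Fin n → Fin p → Fin p → ℝ) : ℝ :=
  2 / ((n : ℝ) * ((n : ℝ) - 1)) *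
    Real.sqrt (∑ i : Fin n, ∑ j : Fin n, ∑ r : Fin p, ∑ s : Fin p,
      if i < j ∧ r < s then Rp i j r s ^ 2 else 0)

/-- The Ricci curvature `Ric(e_b, e_c) = sum_a R(e_a, e_b, e_c, e_a)` computed from the
components of the curvature tensor in an orthonormal frame. -/
noncomputable def ambRicci {m : ℕ} (Rt : Fin m → Fin m → Fin m → Fin m → ℝ)
    (b c : Fin m) : ℝ :=
  ∑ a : Fin m, Rt a b c a

/-- The (ambient) scalar curvature `tau = sum_{a<b} sigma(e_a, e_b) = (1/2) sum_a Ric(e_a,e_a)`. -/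
noncomputable def ambScalar {m : ℕ} (Rt : Fin m → Fin m → Fin m → Fin m → ℝ) : ℝ :=
  (1 / 2) * ∑ a : Fin m, ambRicci Rt a a

/-- If `∑ lᵢ² ≤ 1`, the pairs with `(lᵢ - lⱼ)² > 1` all share a common index. -/
theorem exists_common_index {ι : Type*} [Fintype ι] [DecidableEq ι] (l : ι → ℝ)
    (hl : ∑ i, l i ^ 2 ≤ 1) (a b : ι) (hab : 1 < (l a - l b) ^ 2) :
    ∃ c, ∀ i j, 1 < (l i - l j) ^ 2 → i = c ∨ j = c := by
  have ne : ∀ i j, 1 < (l i - l j) ^ 2 → i ≠ j := by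
    rintro i j h rfl
    norm_num at h
  have sub : ∀ s : Finset ι, ∑ i ∈ s, l i ^ 2 ≤ 1 := fun s =>
    (sum_le_sum_of_subset_of_nonneg (subset_univ s) fun i _ _ => sq_nonneg _).trans hl
  have disj : ∀ i j u v, 1 < (l i - l j) ^ 2 → 1 < (l u - l v) ^ 2 →
      i = u ∨ i = v ∨ j = u ∨ j = v := by
    intro i j u v h1 h2
    by_contra! hne
    obtain ⟨h3, h4, h5, h6⟩ := hne
    have := sub {i, j, u, v}
    rw [sum_insert (by simp [ne i j h1, h3, h4]), sum_insert (by simp [h5, h6]),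
      sum_pair (ne u v h2)] at this
    nlinarith [sq_nonneg (l i + l j), sq_nonneg (l u + l v)]
  have tri : ∀ i j u, 1 < (l i - l j) ^ 2 → 1 < (l j - l u) ^ 2 → 1 < (l i - l u) ^ 2 →
      False := by
    intro i j u h1 h2 h3
    have := sub {i, j, u}
    rw [sum_insert (by simp [ne i j h1, ne i u h3]), sum_pair (ne j u h2)] at this
    nlinarith [sq_nonneg (l i + l j + l u)]
  have comm : ∀ i j, 1 < (l i - l j) ^ 2 → 1 < (l j - l i) ^ 2 := by
    intro i j h
    linarith [sub_sq_comm (l i) (l j)]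
  by_contra! hno
  obtain ⟨i, j, hij, hi, hj⟩ := hno a
  obtain ⟨u, v, huv, hu, hv⟩ := hno b
  have hbi : ∃ w, w ≠ a ∧ 1 < (l b - l w) ^ 2 := by
    rcases disj a b i j hab hij with h | h | h | h
    · exact absurd h.symm hi
    · exact absurd h.symm hj
    · exact ⟨j, hj, h ▸ hij⟩
    · exact ⟨i, hi, h ▸ comm i j hij⟩
  have hau : ∃ w, w ≠ b ∧ 1 < (l a - l w) ^ 2 := by
    rcases disj a b u v hab huv with h | h | h | h
    · exact ⟨v, hv, h ▸ huv⟩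
    · exact ⟨u, hu, h ▸ comm u v huv⟩
    · exact absurd h.symm hu
    · exact absurd h.symm hv
  obtain ⟨w, hwa, hw⟩ := hbi
  obtain ⟨z, hzb, hz⟩ := hau
  rcases disj b w a z hw hz with h | h | h | h
  · exact ne a b hab h.symm
  · exact hzb h.symm
  · exact hwa h
  · subst h
    exact tri a b w hab hw hz

/-- The positive parts of `(l_c - lⱼ)² - 1` sum to at most `1`: the Laplacian of a star with `k`
leaves has largest eigenvalue `k + 1`. -/
theorem sum_star_le {ι : Type*} [Fintype ι] [DecidableEq ι] (l : ι → ℝ)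
    (hl : ∑ i, l i ^ 2 ≤ 1) (c : ι) :
    ∑ j, max ((l c - l j) ^ 2 - 1) 0 ≤ 1 := by
  set J : Finset ι := univ.filter fun j => 1 < (l c - l j) ^ 2 with hJ
  have hcJ : c ∉ J := by simp [hJ]
  have hsum : ∑ j, max ((l c - l j) ^ 2 - 1) 0 = ∑ j ∈ J, ((l c - l j) ^ 2 - 1) := by
    rw [hJ, sum_filter]
    refine sum_congr rfl fun j _ => ?_
    split_ifs with h
    · exact max_eq_left (by linarith)
    · exact max_eq_right (by linarith)
  have hsub : l c ^ 2 + ∑ j ∈ J, l j ^ 2 ≤ 1 := by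
    rw [← sum_insert hcJ (f := fun i => l i ^ 2)]
    exact (sum_le_sum_of_subset_of_nonneg (subset_univ _) fun i _ _ => sq_nonneg _).trans hl
  have hcs : (∑ j ∈ J, l j) ^ 2 ≤ #J * ∑ j ∈ J, l j ^ 2 := sq_sum_le_card_mul_sum_sq
  have hexp : ∑ j ∈ J, ((l c - l j) ^ 2 - 1) =
      #J * l c ^ 2 - 2 * l c * ∑ j ∈ J, l j + ∑ j ∈ J, l j ^ 2 - #J := by
    simp only [sub_sq, sum_sub_distrib, sum_add_distrib, ← mul_sum, sum_const, nsmul_eq_mul,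
      mul_one]
  rw [hsum, hexp]
  nlinarith [sq_nonneg (l c + ∑ j ∈ J, l j),
    mul_le_mul_of_nonneg_left hsub (by positivity : (0 : ℝ) ≤ #J + 1)]

theorem sum_sum_max_sq_sub_le {ι : Type*} [Fintype ι] [DecidableEq ι] (l : ι → ℝ)
    (hl : ∑ i, l i ^ 2 ≤ 1) :
    ∑ i, ∑ j, max ((l i - l j) ^ 2 - 1) 0 ≤ 2 := by
  by_cases hex : ∃ a b, 1 < (l a - l b) ^ 2
  · obtain ⟨a, b, hab⟩ := hex
    obtain ⟨c, hc⟩ := exists_common_index l hl a b hab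
    have hle : ∀ i j, max ((l i - l j) ^ 2 - 1) 0 ≤
        (if i = c then max ((l c - l j) ^ 2 - 1) 0 else 0) +
        (if j = c then max ((l c - l i) ^ 2 - 1) 0 else 0) := by
      intro i j
      by_cases hi : i = c
      · subst hi
        rw [if_pos rfl]
        split_ifs <;> simp
      · by_cases hj : j = c
        · subst hj
          simp [hi, sub_sq_comm (l i) (l j)]
        · have : ¬ 1 < (l i - l j) ^ 2 := fun h => (hc i j h).elim hi hj
          simp only [hi, hj, if_false, add_zero]
          exact max_le (by linarith) le_rfl
    refine (sum_le_sum fun i _ => sum_le_sum fun j _ => hle i j).trans ?_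
    simp only [sum_add_distrib]
    rw [sum_comm]
    simp only [sum_ite_eq', mem_univ, if_true]
    linarith [sum_star_le l hl c]
  · push Not at hex
    rw [sum_eq_zero fun i _ => sum_eq_zero fun j _ => max_eq_right (by linarith [hex i j])]
    norm_num

/-- A symmetric kernel all of whose square restrictions have nonnegative row sums is copositive. -/
theorem quadratic_nonneg_of_row_sums {κ : Type*} [DecidableEq κ] (d : κ → κ → ℝ)
    (hd : ∀ a b, d a b = d b a) (S : Finset κ) :
    ∀ x : κ → ℝ, (∀ a ∈ S, 0 ≤ x a) → (∀ T ⊆ S, ∀ a ∈ T, 0 ≤ ∑ b ∈ T, d a b) →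
      0 ≤ ∑ a ∈ S, ∑ b ∈ S, d a b * (x a * x b) := by
  induction S using Finset.strongInduction with
  | H S ih =>
    intro x hx hT
    rcases S.eq_empty_or_nonempty with rfl | hS
    · simp
    obtain ⟨m, hmS, hm⟩ := S.exists_min_image x hS
    set S' := S.filter fun a => x m < x a with hS'
    have hss : S' ⊂ S := (filter_ssubset).2 ⟨m, hmS, lt_irrefl _⟩
    have hy0 : ∀ a ∈ S, a ∉ S' → x a - x m = 0 := by
      intro a ha ha'
      have : ¬ x m < x a := fun h => ha' (mem_filter.2 ⟨ha, h⟩)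
      linarith [hm a ha]
    have hrec := ih S' hss (fun a => x a - x m)
      (fun a ha => by linarith [(mem_filter.1 ha).2])
      (fun T hTS => hT T (hTS.trans hss.subset))
    have hext : ∑ a ∈ S', ∑ b ∈ S', d a b * ((x a - x m) * (x b - x m)) =
        ∑ a ∈ S, ∑ b ∈ S, d a b * ((x a - x m) * (x b - x m)) := by
      rw [← sum_subset hss.subset fun a ha ha' => sum_eq_zero fun b _ => by
        rw [hy0 a ha ha']; ring]
      refine sum_congr rfl fun a _ => sum_subset hss.subset fun b hb hb' => by
        rw [hy0 b hb hb']; ring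
    have hrow : 0 ≤ ∑ a ∈ S, (x m * x a + x m * (x a - x m)) * ∑ b ∈ S, d a b :=
      sum_nonneg fun a ha => mul_nonneg (by nlinarith [hx m hmS, hm a ha, hx a ha])
        (hT S Subset.rfl a ha)
    have hsplit : ∑ a ∈ S, ∑ b ∈ S, d a b * (x a * x b) =
        ∑ a ∈ S, ∑ b ∈ S, d a b * ((x a - x m) * (x b - x m)) +
        ∑ a ∈ S, (x m * x a + x m * (x a - x m)) * ∑ b ∈ S, d a b := by
      have hsw : ∑ a ∈ S, ∑ b ∈ S, d a b * (x m * x b) =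
          ∑ a ∈ S, ∑ b ∈ S, d a b * (x m * x a) := by
        rw [sum_comm]
        exact sum_congr rfl fun a _ => sum_congr rfl fun b _ => by rw [hd]
      rw [← sub_eq_zero]
      rw [← sub_eq_zero] at hsw
      rw [← hsw]
      simp only [mul_sum, ← sum_add_distrib, ← sum_sub_distrib]
      exact sum_congr rfl fun a _ => sum_congr rfl fun b _ => by ring
    rw [hsplit, ← hext]
    exact add_nonneg hrec hrow

section DDVV

variable {ι κ : Type*} [Fintype ι]

theorem trace_mul_self_eq_sum_sq {A : Matrix ι ι ℝ} (hA : A.IsSymm) :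
    (A * A).trace = ∑ i, ∑ j, A i j ^ 2 := by
  simp only [Matrix.trace, Matrix.diag_apply, Matrix.mul_apply]
  exact sum_congr rfl fun i _ => sum_congr rfl fun j _ => by rw [hA.apply i j, sq]

/-- Bessel's inequality for an off-diagonal entry of an orthonormal family of symmetric
matrices. -/
theorem sum_sq_apply_le_half [DecidableEq ι] [DecidableEq κ] (T : Finset κ) (B : κ → Matrix ι ι ℝ)
    (hB : ∀ b, (B b).IsSymm)
    (horth : ∀ b ∈ T, ∀ c ∈ T, (B b * B c).trace = if b = c then 1 else 0)
    {i j : ι} (hij : i ≠ j) : ∑ b ∈ T, B b i j ^ 2 ≤ 1 / 2 := by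
  set E : Matrix ι ι ℝ := ∑ b ∈ T, B b i j • B b with hE
  set s := ∑ b ∈ T, B b i j ^ 2 with hs
  have hsymm : E.IsSymm := by
    rw [Matrix.IsSymm, hE, Matrix.transpose_sum]
    exact sum_congr rfl fun b _ => by rw [Matrix.transpose_smul, hB b]
  have hEij : E i j = s := by
    rw [hE, hs, Matrix.sum_apply]
    exact sum_congr rfl fun b _ => by rw [Matrix.smul_apply, smul_eq_mul, sq]
  have hEji : E j i = s := by rw [hsymm.apply i j, hEij]
  have hnorm : (E * E).trace = s := by
    rw [hE, hs, Finset.sum_mul_sum, Matrix.trace_sum]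
    refine sum_congr rfl fun b hb => ?_
    rw [Matrix.trace_sum, sum_eq_single b]
    · simp [horth b hb b hb, sq]
    · intro c hc hcb
      simp [horth b hb c hc, hcb.symm]
    · exact fun h => absurd hb h
  have hge : s ^ 2 + s ^ 2 ≤ ∑ k, ∑ l, E k l ^ 2 := by
    rw [← Fintype.sum_prod_type' (fun k l => E k l ^ 2)]
    have hne : (i, j) ≠ (j, i) := fun h => hij (Prod.ext_iff.1 h).1
    have := sum_le_sum_of_subset_of_nonneg (subset_univ {(i, j), (j, i)})
      (f := fun p : ι × ι => E p.1 p.2 ^ 2) fun _ _ _ => sq_nonneg _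
    rw [sum_pair hne] at this
    simpa [hEij, hEji] using this
  rw [← trace_mul_self_eq_sum_sq hsymm, hnorm] at hge
  by_contra! h
  nlinarith

theorem sum_sq_sub_mul_sq_le [DecidableEq ι] [DecidableEq κ] (l : ι → ℝ) (hl : ∑ i, l i ^ 2 ≤ 1)
    (T : Finset κ) (B : κ → Matrix ι ι ℝ) (hB : ∀ b, (B b).IsSymm)
    (horth : ∀ b ∈ T, ∀ c ∈ T, (B b * B c).trace = if b = c then 1 else 0) :
    ∑ b ∈ T, ∑ i, ∑ j, (l i - l j) ^ 2 * B b i j ^ 2 ≤ #T + 1 := by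
  have hcard : (#T : ℝ) = ∑ b ∈ T, ∑ i, ∑ j, B b i j ^ 2 := by
    rw [sum_congr rfl fun b hb => by
      rw [← trace_mul_self_eq_sum_sq (hB b), horth b hb b hb, if_pos rfl]]
    simp
  have hbound : ∑ b ∈ T, ∑ i, ∑ j, ((l i - l j) ^ 2 - 1) * B b i j ^ 2 ≤ 1 := by
    rw [sum_comm]
    calc ∑ i, ∑ b ∈ T, ∑ j, ((l i - l j) ^ 2 - 1) * B b i j ^ 2
        = ∑ i, ∑ j, ((l i - l j) ^ 2 - 1) * ∑ b ∈ T, B b i j ^ 2 := by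
          refine sum_congr rfl fun i _ => ?_
          rw [sum_comm]
          simp only [mul_sum]
      _ ≤ ∑ i, ∑ j, max ((l i - l j) ^ 2 - 1) 0 * (1 / 2) := by
          refine sum_le_sum fun i _ => sum_le_sum fun j _ => ?_
          have h0 : 0 ≤ ∑ b ∈ T, B b i j ^ 2 := sum_nonneg fun _ _ => sq_nonneg _
          by_cases hij : i = j
          · subst hij
            simpa using h0
          · exact (mul_le_mul_of_nonneg_right (le_max_left _ _) h0).trans
              (mul_le_mul_of_nonneg_left (sum_sq_apply_le_half T B hB horth hij)
                (le_max_right _ _))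
      _ ≤ 1 := by
          simp only [← sum_mul]
          linarith [sum_sum_max_sq_sub_le l hl]
  simp only [sub_mul _ (1 : ℝ), one_mul, sum_sub_distrib] at hbound
  linarith

/-- The squared Frobenius norm of the commutator of two symmetric matrices. -/
def commSq (A B : Matrix ι ι ℝ) : ℝ := -((A * B - B * A) * (A * B - B * A)).trace

theorem commSq_self (A : Matrix ι ι ℝ) : commSq A A = 0 := by simp [commSq]

theorem commSq_comm (A B : Matrix ι ι ℝ) : commSq A B = commSq B A := by
  rw [commSq, commSq, ← neg_sub (B * A), neg_mul_neg]

theorem commSq_smul_smul (a b : ℝ) (A B : Matrix ι ι ℝ) :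
    commSq (a • A) (b • B) = a ^ 2 * b ^ 2 * commSq A B := by
  have : a • A * b • B - b • B * a • A = (a * b) • (A * B - B * A) := by
    simp only [Matrix.smul_mul, Matrix.mul_smul, smul_smul, smul_sub, mul_comm]
  rw [commSq, commSq, this]
  simp only [Matrix.smul_mul, Matrix.mul_smul, Matrix.trace_smul, smul_eq_mul]
  ring

theorem commSq_diagonal [DecidableEq ι] (l : ι → ℝ) {B : Matrix ι ι ℝ} (hB : B.IsSymm) :
    commSq (diagonal l) B = ∑ i, ∑ j, (l i - l j) ^ 2 * B i j ^ 2 := by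
  simp only [commSq, Matrix.trace, Matrix.diag_apply, Matrix.mul_apply (M := _ - _),
    Matrix.sub_apply, Matrix.diagonal_mul, Matrix.mul_diagonal, ← sum_neg_distrib]
  refine sum_congr rfl fun i _ => sum_congr rfl fun j _ => ?_
  rw [hB.apply i j]
  ring

/-- A real symmetric matrix is orthogonally diagonalizable. -/
theorem exists_orthogonal_diagonal [DecidableEq ι] {A : Matrix ι ι ℝ} (hA : A.IsSymm) :
    ∃ (O : Matrix ι ι ℝ) (l : ι → ℝ), O * Oᵀ = 1 ∧ Oᵀ * A * O = diagonal l := by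
  have hH : A.IsHermitian := by
    rwa [Matrix.IsHermitian, Matrix.conjTranspose_eq_transpose_of_trivial]
  set U := hH.eigenvectorUnitary
  have h1 : (U : Matrix ι ι ℝ) * (U : Matrix ι ι ℝ)ᵀ = 1 := by
    simpa [Matrix.star_eq_conjTranspose] using Unitary.coe_mul_star_self U
  refine ⟨U, hH.eigenvalues, h1, ?_⟩
  have := hH.conjStarAlgAut_star_eigenvectorUnitary
  rw [Unitary.conjStarAlgAut_star_apply] at this
  simpa [Matrix.star_eq_conjTranspose] using this

theorem trace_conj_mul_conj [DecidableEq ι] {O : Matrix ι ι ℝ} (hO : O * Oᵀ = 1)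
    (X Y : Matrix ι ι ℝ) :
    ((Oᵀ * X * O) * (Oᵀ * Y * O)).trace = (X * Y).trace := by
  have : (Oᵀ * X * O) * (Oᵀ * Y * O) = Oᵀ * (X * (O * Oᵀ) * Y * O) := by
    simp only [Matrix.mul_assoc]
  rw [this, hO, Matrix.trace_mul_comm, Matrix.mul_one, Matrix.mul_assoc, hO, Matrix.mul_one]

theorem commSq_conj [DecidableEq ι] {O : Matrix ι ι ℝ} (hO : O * Oᵀ = 1) (A B : Matrix ι ι ℝ) :
    commSq (Oᵀ * A * O) (Oᵀ * B * O) = commSq A B := by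
  have hmul : ∀ X Y : Matrix ι ι ℝ, (Oᵀ * X * O) * (Oᵀ * Y * O) = Oᵀ * (X * Y) * O := by
    intro X Y
    have : (Oᵀ * X * O) * (Oᵀ * Y * O) = Oᵀ * (X * (O * Oᵀ) * Y) * O := by
      simp only [Matrix.mul_assoc]
    rw [this, hO, Matrix.mul_one]
  rw [commSq, commSq, hmul, hmul, ← Matrix.sub_mul, ← Matrix.mul_sub, trace_conj_mul_conj hO]

theorem sum_commSq_le_card_add_one [DecidableEq ι] [DecidableEq κ] {A : Matrix ι ι ℝ}
    (hA : A.IsSymm) (hA1 : (A * A).trace = 1) (T : Finset κ) (B : κ → Matrix ι ι ℝ)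
    (hB : ∀ b, (B b).IsSymm)
    (horth : ∀ b ∈ T, ∀ c ∈ T, (B b * B c).trace = if b = c then 1 else 0) :
    ∑ b ∈ T, commSq A (B b) ≤ #T + 1 := by
  obtain ⟨O, l, hO, hd⟩ := exists_orthogonal_diagonal hA
  have hl : ∑ i, l i ^ 2 ≤ 1 := by
    rw [← trace_conj_mul_conj hO, hd, Matrix.diagonal_mul_diagonal, Matrix.trace_diagonal] at hA1
    simp only [sq, hA1, le_refl]
  have hB' : ∀ b, (Oᵀ * B b * O).IsSymm := by
    intro b
    rw [Matrix.IsSymm, Matrix.transpose_mul, Matrix.transpose_mul, Matrix.transpose_transpose,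
      hB b, Matrix.mul_assoc]
  have := sum_sq_sub_mul_sq_le l hl T (fun b => Oᵀ * B b * O) hB' fun b hb c hc => by
    rw [trace_conj_mul_conj hO, horth b hb c hc]
  refine le_trans (le_of_eq (sum_congr rfl fun b _ => ?_)) this
  rw [← commSq_diagonal l (hB' b), ← hd, commSq_conj hO]

/-- The DDVV inequality for a Frobenius-orthogonal family of symmetric matrices. -/
theorem sum_commSq_le_of_orthogonal [DecidableEq ι] [Fintype κ] [DecidableEq κ]
    (A : κ → Matrix ι ι ℝ)
    (hA : ∀ a, (A a).IsSymm) (horth : ∀ a b, a ≠ b → (A a * A b).trace = 0) :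
    ∑ a, ∑ b, commSq (A a) (A b) ≤ (∑ a, (A a * A a).trace) ^ 2 := by
  set x : κ → ℝ := fun a => (A a * A a).trace with hx
  have hx0 : ∀ a, 0 ≤ x a := fun a => by
    simp only [hx, trace_mul_self_eq_sum_sq (hA a)]
    positivity
  have hzero : ∀ a, x a = 0 → A a = 0 := by
    intro a ha
    simp only [hx] at ha
    refine Matrix.trace_conjTranspose_mul_self_eq_zero_iff.1 ?_
    rwa [Matrix.conjTranspose_eq_transpose_of_trivial, hA a]
  set S : Finset κ := univ.filter fun a => x a ≠ 0 with hS
  have hpos : ∀ a ∈ S, 0 < x a := fun a ha => (hx0 a).lt_of_ne' (mem_filter.1 ha).2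
  have hrow : ∀ T ⊆ S, ∀ a ∈ T,
      0 ≤ ∑ b ∈ T, (1 - commSq (A a) (A b) / (x a * x b)) := by
    intro T hTS a ha
    have hsq : ∀ b ∈ S, (√(x b))⁻¹ ^ 2 * x b = 1 := fun b hb => by
      rw [inv_pow, Real.sq_sqrt (hx0 b), inv_mul_cancel₀ (hpos b hb).ne']
    have hs : ∀ b, ((√(x b))⁻¹ • A b).IsSymm := fun b => (hA b).smul _
    have hnorm : ∀ b ∈ S, ((√(x b))⁻¹ • A b * (√(x b))⁻¹ • A b).trace = 1 := fun b hb => by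
      rw [← hsq b hb]
      simp only [Matrix.smul_mul, Matrix.mul_smul, Matrix.trace_smul, smul_eq_mul, hx]
      ring
    have := sum_commSq_le_card_add_one (hs a) (hnorm a (hTS ha)) (T.erase a)
      (fun b => (√(x b))⁻¹ • A b) hs fun b hb c hc => by
        split_ifs with h
        · subst h
          exact hnorm b (hTS (mem_of_mem_erase hb))
        · simp [horth b c h]
    have hcard : (#(T.erase a) : ℝ) + 1 = #T := by exact_mod_cast card_erase_add_one ha
    rw [hcard, sum_erase (f := fun b => commSq ((√(x a))⁻¹ • A a) ((√(x b))⁻¹ • A b)) T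
      (commSq_self _)] at this
    rw [sum_sub_distrib, sum_const, nsmul_eq_mul, mul_one, sub_nonneg]
    refine le_trans (le_of_eq (sum_congr rfl fun b _ => ?_)) this
    rw [commSq_smul_smul, inv_pow, inv_pow, Real.sq_sqrt (hx0 a), Real.sq_sqrt (hx0 b),
      div_eq_inv_mul, mul_inv]
  have key := quadratic_nonneg_of_row_sums
    (fun a b => 1 - commSq (A a) (A b) / (x a * x b))
    (fun a b => by simp only [commSq_comm (A a), mul_comm (x a)]) S x (fun a _ => hx0 a) hrow
  have hext : ∑ a ∈ S, ∑ b ∈ S, (1 - commSq (A a) (A b) / (x a * x b)) * (x a * x b) =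
      ∑ a, ∑ b, (x a * x b - commSq (A a) (A b)) := by
    have hSc : ∀ a, a ∉ S → x a = 0 := fun a ha => by simpa [hS] using ha
    rw [← sum_subset (subset_univ S) fun a _ ha => sum_eq_zero fun b _ => by
      simp [hSc a ha, hzero a (hSc a ha), commSq]]
    refine sum_congr rfl fun a ha => ?_
    rw [← sum_subset (subset_univ S) fun b _ hb => by
      simp [hSc b hb, hzero b (hSc b hb), commSq]]
    refine sum_congr rfl fun b hb => ?_
    have := (hpos a ha).ne'
    have := (hpos b hb).ne'
    field_simp
  rw [hext] at key
  simp only [sum_sub_distrib, ← sum_mul_sum] at key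
  rw [sq]
  linarith

/-- The diagonal sum of a bilinear map is invariant under an orthogonal change of family. -/
theorem sum_bilin_orthogonal_combination {M : Type*} [AddCommGroup M] [Module ℝ M] [Fintype κ]
    [DecidableEq κ] (f : M →ₗ[ℝ] M →ₗ[ℝ] ℝ) {O : Matrix κ κ ℝ} (hO : O * Oᵀ = 1) (A : κ → M) :
    ∑ r, f (∑ s, O s r • A s) (∑ s, O s r • A s) = ∑ s, f (A s) (A s) := by
  have hentry : ∀ s t, ∑ r, O s r * O t r = if s = t then 1 else 0 := fun s t => by
    rw [← Matrix.one_apply, ← hO, Matrix.mul_apply]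
    rfl
  simp only [map_sum, map_smul, LinearMap.sum_apply, LinearMap.smul_apply, smul_eq_mul]
  calc ∑ r, ∑ t, O t r * ∑ s, O s r * f (A s) (A t)
      = ∑ t, ∑ s, (∑ r, O s r * O t r) * f (A s) (A t) := by
        rw [sum_comm]
        refine sum_congr rfl fun t _ => ?_
        simp only [mul_sum, sum_mul]
        rw [sum_comm]
        exact sum_congr rfl fun s _ => sum_congr rfl fun r _ => by ring
    _ = ∑ s, f (A s) (A s) := by simp [hentry]

/-- The polarization of `commSq X` as a bilinear map. -/
def commBilin (X : Matrix ι ι ℝ) : Matrix ι ι ℝ →ₗ[ℝ] Matrix ι ι ℝ →ₗ[ℝ] ℝ :=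
  LinearMap.mk₂ ℝ (fun Y Z => -((X * Y - Y * X) * (X * Z - Z * X)).trace)
    (fun Y Y' Z => by
      rw [Matrix.mul_add, Matrix.add_mul, add_sub_add_comm, Matrix.add_mul, Matrix.trace_add,
        neg_add])
    (fun c Y Z => by
      rw [Matrix.mul_smul, Matrix.smul_mul, ← smul_sub, Matrix.smul_mul, Matrix.trace_smul,
        smul_neg])
    (fun Y Z Z' => by
      rw [Matrix.mul_add X, Matrix.add_mul, add_sub_add_comm, Matrix.mul_add, Matrix.trace_add,
        neg_add])
    (fun c Y Z => by
      rw [Matrix.mul_smul X, Matrix.smul_mul, ← smul_sub, Matrix.mul_smul, Matrix.trace_smul,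
        smul_neg])

/-- The Frobenius pairing `(Y, Z) ↦ trace (Y * Z)` as a bilinear map. -/
def traceBilin (ι : Type*) [Fintype ι] : Matrix ι ι ℝ →ₗ[ℝ] Matrix ι ι ℝ →ₗ[ℝ] ℝ :=
  LinearMap.mk₂ ℝ (fun Y Z => (Y * Z).trace)
    (fun Y Y' Z => by rw [Matrix.add_mul, Matrix.trace_add])
    (fun c Y Z => by rw [Matrix.smul_mul, Matrix.trace_smul])
    (fun Y Z Z' => by rw [Matrix.mul_add, Matrix.trace_add])
    (fun c Y Z => by rw [Matrix.mul_smul, Matrix.trace_smul])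

/-- The DDVV inequality: `∑ ‖[Aₐ, A_b]‖² ≤ (∑ ‖Aₐ‖²)²` for real symmetric matrices. -/
theorem sum_commSq_le_sq_sum_trace [DecidableEq ι] [Fintype κ] [DecidableEq κ]
    (A : κ → Matrix ι ι ℝ)
    (hA : ∀ a, (A a).IsSymm) :
    ∑ a, ∑ b, commSq (A a) (A b) ≤ (∑ a, (A a * A a).trace) ^ 2 := by
  set G : Matrix κ κ ℝ := Matrix.of fun r s => (A r * A s).trace with hG
  have hGs : G.IsSymm := by
    ext r s
    simp [hG, Matrix.trace_mul_comm (A r)]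
  obtain ⟨O, l, hO, hd⟩ := exists_orthogonal_diagonal hGs
  set A' : κ → Matrix ι ι ℝ := fun r => ∑ s, O s r • A s with hA'
  have hA's : ∀ r, (A' r).IsSymm := by
    intro r
    rw [Matrix.IsSymm, hA', Matrix.transpose_sum]
    exact sum_congr rfl fun b _ => by rw [Matrix.transpose_smul, hA b]
  have horth : ∀ a b, a ≠ b → (A' a * A' b).trace = 0 := by
    intro a b hab
    have h := congrFun (congrFun hd a) b
    rw [Matrix.diagonal_apply_ne _ hab] at h
    rw [← h, hA']
    simp only [Matrix.mul_sum, Matrix.trace_sum, Matrix.mul_apply, Matrix.transpose_apply,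
      Matrix.smul_mul, Matrix.mul_smul, Matrix.trace_smul, smul_eq_mul, hG, Matrix.of_apply,
      sum_mul]
    rw [sum_comm]
    exact sum_congr rfl fun s _ => sum_congr rfl fun t _ => by ring
  have hinv : ∀ X, ∑ r, commSq X (A' r) = ∑ r, commSq X (A r) := fun X =>
    sum_bilin_orthogonal_combination (commBilin X) hO A
  have htr : ∑ r, (A' r * A' r).trace = ∑ r, (A r * A r).trace :=
    sum_bilin_orthogonal_combination (traceBilin ι) hO A
  have hcomm : ∑ a, ∑ b, commSq (A' a) (A' b) = ∑ a, ∑ b, commSq (A a) (A b) := by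
    simp only [hinv]
    rw [sum_comm]
    simp only [commSq_comm (A' _), hinv]
  rw [← hcomm, ← htr]
  exact sum_commSq_le_of_orthogonal A' hA's horth

end DDVV

/-- A symmetric function vanishing on the diagonal has twice its sum over `i < j` as full sum. -/
theorem two_mul_sum_lt_eq_sum {n : ℕ} (f : Fin n → Fin n → ℝ) (hf : ∀ i j, f i j = f j i)
    (hd : ∀ i, f i i = 0) :
    2 * ∑ i, ∑ j, (if i < j then f i j else 0) = ∑ i, ∑ j, f i j := by
  have hswap : ∑ i, ∑ j, (if i < j then f i j else 0) =
      ∑ i, ∑ j, (if j < i then f i j else 0) := by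
    rw [sum_comm]
    exact sum_congr rfl fun i _ => sum_congr rfl fun j _ => by rw [hf]
  rw [two_mul]
  nth_rewrite 2 [hswap]
  simp only [← sum_add_distrib]
  refine sum_congr rfl fun i _ => sum_congr rfl fun j _ => ?_
  rcases lt_trichotomy i j with h | h | h
  · simp [h, h.asymm]
  · subst h
    simp [hd]
  · simp [h, h.asymm]

/-- The DDVV inequality for the trace-free parts of the shape operators. -/
theorem two_mul_sqrt_KN_le {n p : ℕ} (hn : n ≠ 0) (A : Fin p → Matrix (Fin n) (Fin n) ℝ)
    (hA : ∀ r, (A r).IsSymm) :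
    2 * √(KN A) ≤ ∑ r, ((A r * A r).trace - (A r).trace ^ 2 / n) := by
  have hn' : (n : ℝ) ≠ 0 := Nat.cast_ne_zero.2 hn
  set B : Fin p → Matrix (Fin n) (Fin n) ℝ := fun r => A r - ((A r).trace / n) • 1 with hB
  have hBs : ∀ r, (B r).IsSymm := fun r => (hA r).sub (Matrix.isSymm_one.smul _)
  have hcomm : ∀ r s, B r * B s - B s * B r = A r * A s - A s * A r := by
    intro r s
    simp only [hB, Matrix.sub_mul, Matrix.mul_sub, Matrix.smul_mul, Matrix.mul_smul,
      Matrix.one_mul, Matrix.mul_one]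
    module
  have htr : ∀ r, (B r * B r).trace = (A r * A r).trace - (A r).trace ^ 2 / n := by
    intro r
    simp only [hB, Matrix.sub_mul, Matrix.mul_sub, Matrix.smul_mul, Matrix.mul_smul,
      Matrix.one_mul, Matrix.mul_one, Matrix.trace_sub, Matrix.trace_smul, Matrix.trace_one,
      Fintype.card_fin, smul_eq_mul]
    field_simp
    ring
  have hKN : ∑ r, ∑ s, commSq (B r) (B s) = 4 * KN A := by
    simp only [commSq, hcomm, KN, sum_neg_distrib]
    ring
  have hddvv := sum_commSq_le_sq_sum_trace B hBs
  rw [hKN] at hddvv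
  simp only [← htr]
  have h0 : 0 ≤ ∑ r, (B r * B r).trace := sum_nonneg fun r _ => by
    rw [trace_mul_self_eq_sum_sq (hBs r)]
    positivity
  have : √(KN A) ≤ (∑ r, (B r * B r).trace) / 2 :=
    Real.sqrt_le_iff.2 ⟨by positivity, by linarith [div_pow (∑ r, (B r * B r).trace) 2 2]⟩
  linarith

/-- **Generalized Wintgen inequality in a manifold of quasi-constant curvature
(`ρ_N` version).**  Here the ambient curvature has the quasi-constant form (hypothesis
`quasi`) with functions `p, q` and unit vector field `V` with components `ψ` in the
adapted orthonormal frame (the first `n` vectors being tangent to the submanifold), and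
`gauss` is the Gauss equation.  Then `ρ + ρ_N ≤ ‖H‖² + p + (2q/n) ‖V^T‖²`. -/
theorem wintgen_rhoN_quasi_constant {n m : ℕ} (hn : 3 ≤ n) (hm : 4 ≤ m) (hnm : n ≤ m)
    (Rt : Fin m → Fin m → Fin m → Fin m → ℝ)
    (R : Fin n → Fin n → Fin n → Fin n → ℝ)
    (h : Fin (m - n) → Matrix (Fin n) (Fin n) ℝ)
    (hsymm : ∀ r, (h r).IsSymm)
    (p q : ℝ) (ψ : Fin m → ℝ) (hψ : ∑ x : Fin m, ψ x ^ 2 = 1)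
    (quasi : ∀ x y z w : Fin m, Rt x y z w =
      p * (kdelta y z * kdelta x w - kdelta x z * kdelta y w)
      + q * (kdelta x w * ψ y * ψ z - kdelta x z * ψ y * ψ w
          + kdelta y z * ψ x * ψ w - kdelta y w * ψ x * ψ z))
    (gauss : ∀ i j k l : Fin n, R i j k l =
      Rt (Fin.castLE hnm i) (Fin.castLE hnm j) (Fin.castLE hnm k) (Fin.castLE hnm l)
      + ∑ r : Fin (m - n), (h r i l * h r j k - h r i k * h r j l)) :
    normScalarCurv R + rhoN h ≤
      meanCurvSq h + p + 2 * q / (n : ℝ) * ∑ j : Fin n, ψ (Fin.castLE hnm j) ^ 2 := by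
  have hn3 : (3 : ℝ) ≤ n := by exact_mod_cast hn
  have hn0 : (0 : ℝ) < n := by linarith
  have hn1 : (0 : ℝ) < (n : ℝ) - 1 := by linarith
  have hδ : ∀ i j : Fin n, kdelta (Fin.castLE hnm i) (Fin.castLE hnm j) =
      if i = j then 1 else 0 := fun i j => by simp [kdelta, Fin.ext_iff]
  set v : Fin n → ℝ := fun i => ψ (Fin.castLE hnm i) with hv
  have hR : ∀ i j, R i j j i = p * (1 - if i = j then 1 else 0)
      + q * (v j ^ 2 + v i ^ 2 - (if i = j then 2 * v i ^ 2 else 0))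
      + ∑ r, (h r i i * h r j j - h r i j ^ 2) := by
    intro i j
    rw [gauss, quasi]
    simp only [hδ]
    congr 1
    · by_cases hij : i = j
      · subst hij
        simp only [if_true]
        ring
      · simp only [hij, Ne.symm hij, if_false, if_true, hv]
        ring
    · exact sum_congr rfl fun r _ => by rw [(hsymm r).apply i j, sq]
  have hτ : 2 * scalarCurv R = p * (n * (n - 1)) + q * (2 * (n - 1) * ∑ j, v j ^ 2)
      + ∑ r, ((h r).trace ^ 2 - (h r * h r).trace) := by
    rw [scalarCurv, two_mul_sum_lt_eq_sum (fun i j => R i j j i)]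
    · simp only [hR, sum_add_distrib, ← mul_sum]
      congr 1
      · congr 1
        · congr 1
          simp [sum_sub_distrib]
          ring
        · congr 1
          simp [sum_sub_distrib, sum_add_distrib, ← mul_sum]
          ring
      · simp only [trace_mul_self_eq_sum_sq (hsymm _)]
        simp only [Matrix.trace, Matrix.diag_apply, sq, sum_mul_sum, ← sum_sub_distrib]
        rw [sum_comm_cycle]
    · intro i j
      simp only [hR, eq_comm (a := j)]
      have hsum : ∑ r, (h r i i * h r j j - h r i j ^ 2) =
          ∑ r, (h r j j * h r i i - h r j i ^ 2) :=
        sum_congr rfl fun r _ => by rw [(hsymm r).apply i j, mul_comm]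
      rw [hsum]
      by_cases hij : i = j
      · subst hij
        rfl
      · simp only [hij, if_false]
        ring
    · intro i
      simp only [hR, if_true, sq, sub_self, sum_const_zero]
      ring
  have hH : meanCurvSq h = ∑ r, (h r).trace ^ 2 / (n : ℝ) ^ 2 := by
    refine sum_congr rfl fun r _ => ?_
    simp only [Matrix.trace, Matrix.diag_apply]
    ring
  have hD := two_mul_sqrt_KN_le (by omega) h hsymm
  rw [sum_sub_distrib, ← sum_div] at hD
  rw [sum_sub_distrib] at hτ
  rw [← sum_div] at hH
  rw [normScalarCurv, rhoN, hτ, hH, div_mul_eq_mul_div, ← add_div,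
    div_le_iff₀ (mul_pos hn0 hn1)]
  set a := ∑ r, (h r).trace ^ 2
  set b := ∑ r, (h r * h r).trace
  set w := ∑ j, v j ^ 2
  have hgoal : (a / (n : ℝ) ^ 2 + p + 2 * q / n * w) * (n * (n - 1)) =
      a - a / n + p * (n * (n - 1)) + q * (2 * (n - 1) * w) := by
    field_simp
  rw [hgoal]
  linarith
end

section
/- Let $M^n$, $n \geq 3$, be an $n$-dimensional submanifold of an $m$-dimensional, $m \geq 4$, Riemannian manifold of quasi-constant curvature $(\widetilde{M}^m, \widetilde{g})$ with associated functions $p, q$ and distinguished unit vector field $V$. Then $\rho + \rho^{\perp} \leq \Vert H \Vert^2 + p + \frac{2q}{n}\Vert V^T \Vert^2$, where $V^T$ is the tangential component of $V$ along $M^n$. -/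
open Finset Matrix

/-- The squared Frobenius norm of a real matrix. -/
def frobSq {ι : Type*} [Fintype ι] (M : Matrix ι ι ℝ) : ℝ := ∑ i, ∑ j, M i j ^ 2

section DDVV

variable {ι κ : Type*} [Fintype ι]

lemma frobSq_nonneg (M : Matrix ι ι ℝ) : 0 ≤ frobSq M :=
  sum_nonneg fun _ _ => sum_nonneg fun _ _ => sq_nonneg _

lemma frobSq_smul (c : ℝ) (M : Matrix ι ι ℝ) : frobSq (c • M) = c ^ 2 * frobSq M := by
  simp [frobSq, mul_pow, mul_sum]

lemma frobSq_eq_trace (M : Matrix ι ι ℝ) : frobSq M = (M * Mᵀ).trace := by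
  simp [frobSq, Matrix.trace, Matrix.mul_apply, sq]

lemma frobSq_conj [DecidableEq ι] (O M : Matrix ι ι ℝ) (hO : Oᵀ * O = 1) :
    frobSq (O * M * Oᵀ) = frobSq M := by
  have key : O * M * Oᵀ * (O * M * Oᵀ)ᵀ = O * (M * Mᵀ * Oᵀ) := by
    calc O * M * Oᵀ * (O * M * Oᵀ)ᵀ = O * M * (Oᵀ * O) * Mᵀ * Oᵀ := by
          simp only [Matrix.transpose_mul, Matrix.transpose_transpose, Matrix.mul_assoc]
      _ = O * (M * Mᵀ * Oᵀ) := by rw [hO]; simp only [Matrix.mul_one, Matrix.mul_assoc]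
  rw [frobSq_eq_trace, frobSq_eq_trace, key, Matrix.trace_mul_comm, Matrix.mul_assoc, hO,
    Matrix.mul_one]

/-- Real symmetric matrices are orthogonally diagonalizable. -/
lemma exists_orthogonal_conj_eq_diagonal [DecidableEq ι] (M : Matrix ι ι ℝ) (hM : M.IsSymm) :
    ∃ (O : Matrix ι ι ℝ) (d : ι → ℝ), Oᵀ * O = 1 ∧ O * M * Oᵀ = diagonal d := by
  have hH : M.IsHermitian := by
    rw [Matrix.IsHermitian, Matrix.conjTranspose_eq_transpose_of_trivial]; exact hM
  set U : Matrix ι ι ℝ := (hH.eigenvectorUnitary : Matrix ι ι ℝ) with hU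
  have hstar : star U = Uᵀ := by
    rw [Matrix.star_eq_conjTranspose, Matrix.conjTranspose_eq_transpose_of_trivial]
  have h1 : Uᵀ * U = 1 := by
    rw [← hstar]; exact Unitary.coe_star_mul_self hH.eigenvectorUnitary
  have h2 : U * Uᵀ = 1 := mul_eq_one_comm.mp h1
  have h3 : M = U * diagonal hH.eigenvalues * Uᵀ := by
    have := hH.spectral_theorem
    rw [Unitary.conjStarAlgAut_apply] at this
    rw [← hstar]
    exact this
  refine ⟨Uᵀ, hH.eigenvalues, by rw [Matrix.transpose_transpose, h2], ?_⟩
  rw [Matrix.transpose_transpose]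
  calc Uᵀ * M * U = Uᵀ * (U * diagonal hH.eigenvalues * Uᵀ) * U := by rw [← h3]
    _ = (Uᵀ * U) * diagonal hH.eigenvalues * (Uᵀ * U) := by simp only [Matrix.mul_assoc]
    _ = diagonal hH.eigenvalues := by rw [h1, Matrix.one_mul, Matrix.mul_one]

/-- In a weighted graph, the degrees of the two ends of an edge sum to at most the total weight
plus the weight of that edge. -/
lemma degree_add_degree_le [DecidableEq ι] (u : ι → ι → ℝ) (hu : ∀ i j, 0 ≤ u i j)
    (hs : ∀ i j, u i j = u j i) (h0 : ∀ i, u i i = 0) {i j : ι} (hij : i ≠ j) :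
    2 * (∑ k, u i k + ∑ k, u j k) ≤ (∑ k, ∑ l, u k l) + 2 * u i j := by
  have hpt : ∀ k, u i k + u j k + (if k = i then ∑ l, u i l - u i j else 0)
      + (if k = j then ∑ l, u j l - u i j else 0) ≤ ∑ l, u k l := by
    intro k
    by_cases hki : k = i
    · subst hki; simp [hij, h0, hs j k]
    by_cases hkj : k = j
    · subst hkj; simp [hki, h0]
    simp only [hki, hkj, if_false, add_zero]
    rw [hs i k, hs j k, ← sum_pair hij]
    exact sum_le_sum_of_subset_of_nonneg (subset_univ _) fun l _ _ => hu k l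
  have := sum_le_sum fun k (_ : k ∈ (univ : Finset ι)) => hpt k
  simp only [sum_add_distrib, sum_ite_eq', mem_univ, if_true] at this
  linarith

lemma four_mul_sum_degree_sq_le [DecidableEq ι] (u : ι → ι → ℝ) (hu : ∀ i j, 0 ≤ u i j)
    (hs : ∀ i j, u i j = u j i) (h0 : ∀ i, u i i = 0) :
    4 * ∑ i, (∑ j, u i j) ^ 2 ≤ 2 * ∑ i, ∑ j, u i j ^ 2 + (∑ i, ∑ j, u i j) ^ 2 := by
  have hpt : ∀ i j, u i j * (2 * (∑ k, u i k + ∑ k, u j k)) ≤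
      u i j * ((∑ k, ∑ l, u k l) + 2 * u i j) := by
    intro i j
    by_cases hij : i = j
    · subst hij; simp [h0]
    · exact mul_le_mul_of_nonneg_left (degree_add_degree_le u hu hs h0 hij) (hu i j)
  have hsum := sum_le_sum fun i (_ : i ∈ (univ : Finset ι)) =>
    sum_le_sum fun j (_ : j ∈ (univ : Finset ι)) => hpt i j
  have e1 : ∑ i, ∑ j, u i j * (∑ k, u i k) = ∑ i, (∑ j, u i j) ^ 2 :=
    sum_congr rfl fun i _ => by rw [← sum_mul, sq]
  have e2 : ∑ i, ∑ j, u i j * (∑ k, u j k) = ∑ i, (∑ j, u i j) ^ 2 := by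
    rw [sum_comm, ← e1]
    exact sum_congr rfl fun i _ => sum_congr rfl fun j _ => by rw [hs]
  have e3 : ∑ i, ∑ j, u i j * (2 * (∑ k, u i k + ∑ k, u j k)) =
      4 * ∑ i, (∑ j, u i j) ^ 2 := by
    have : ∀ i j, u i j * (2 * (∑ k, u i k + ∑ k, u j k)) =
      2 * (u i j * ∑ k, u i k) + 2 * (u i j * ∑ k, u j k) := fun i j => by ring
    simp only [this, sum_add_distrib, ← mul_sum _ _ (2 : ℝ)]
    rw [e1, e2]; ring
  have e4 : ∑ i, ∑ j, u i j * ((∑ k, ∑ l, u k l) + 2 * u i j) =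
      2 * ∑ i, ∑ j, u i j ^ 2 + (∑ i, ∑ j, u i j) ^ 2 := by
    have : ∀ i j, u i j * ((∑ k, ∑ l, u k l) + 2 * u i j) =
      u i j * (∑ k, ∑ l, u k l) + 2 * u i j ^ 2 := fun i j => by ring
    simp only [this, sum_add_distrib, ← mul_sum _ _ (2 : ℝ), ← sum_mul]
    ring
  rwa [e3, e4] at hsum

/-- A bound for the weighted Laplacian form with edge weights `2 * w i j ∈ [0, 1]`. -/
lemma sum_weight_mul_sub_sq_le [DecidableEq ι] (w : ι → ι → ℝ) (l : ι → ℝ) (K : ℝ)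
    (hw : ∀ i j, 0 ≤ w i j) (hs : ∀ i j, w i j = w j i) (hb : ∀ i j, i ≠ j → 2 * w i j ≤ 1)
    (hK : ∑ i, ∑ j, w i j ≤ K) :
    ∑ i, ∑ j, w i j * (l i - l j) ^ 2 ≤ (∑ i, l i ^ 2) * (K + 1) := by
  set S := ∑ i, ∑ j, w i j * (l i - l j) ^ 2 with hS
  have hS0 : 0 ≤ S :=
    sum_nonneg fun i _ => sum_nonneg fun j _ => mul_nonneg (hw i j) (sq_nonneg _)
  have hK0 : 0 ≤ K := le_trans (sum_nonneg fun i _ => sum_nonneg fun j _ => hw i j) hK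
  have hL0 : 0 ≤ ∑ i, l i ^ 2 := sum_nonneg fun i _ => sq_nonneg _
  let u : ι → ι → ℝ := fun i j => w i j * |l i - l j|
  have hu : ∀ i j, 0 ≤ u i j := fun i j => mul_nonneg (hw i j) (abs_nonneg _)
  have hdeg := four_mul_sum_degree_sq_le u hu
    (fun i j => by simp only [u]; rw [hs, abs_sub_comm]) (fun i => by simp [u])
  have husq : 2 * ∑ i, ∑ j, u i j ^ 2 ≤ S := by
    simp only [mul_sum, hS]
    refine sum_le_sum fun i _ => sum_le_sum fun j _ => ?_
    simp only [u, mul_pow, sq_abs]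
    by_cases hij : i = j
    · simp [hij]
    · nlinarith [mul_nonneg (mul_nonneg (hw i j) (sub_nonneg.2 (hb i j hij)))
        (sq_nonneg (l i - l j))]
  have husum : (∑ i, ∑ j, u i j) ^ 2 ≤ K * S := by
    have hcs : (∑ x : ι × ι, u x.1 x.2) ^ 2 ≤
        (∑ x : ι × ι, w x.1 x.2) * ∑ x : ι × ι, w x.1 x.2 * (l x.1 - l x.2) ^ 2 := by
      apply sum_sq_le_sum_mul_sum_of_sq_le_mul
      · exact fun x _ => hw _ _
      · exact fun x _ => mul_nonneg (hw _ _) (sq_nonneg _)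
      · intro x _
        simp only [u, mul_pow, sq_abs]
        exact le_of_eq (by ring)
    simp only [Fintype.sum_prod_type] at hcs
    exact hcs.trans (mul_le_mul_of_nonneg_right hK hS0)
  have hv : ∑ i, (∑ j, w i j * (l i - l j)) ^ 2 ≤ ∑ i, (∑ j, u i j) ^ 2 := by
    refine sum_le_sum fun i _ => ?_
    rw [← sq_abs (∑ j, w i j * (l i - l j))]
    refine pow_le_pow_left₀ (abs_nonneg _) ?_ 2
    refine (abs_sum_le_sum_abs _ _).trans (le_of_eq (sum_congr rfl fun j _ => ?_))
    simp only [u, abs_mul, abs_of_nonneg (hw i j)]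
  have hSv : S = 2 * ∑ i, l i * ∑ j, w i j * (l i - l j) := by
    have e1 : S = ∑ i, ∑ j, l i * (w i j * (l i - l j)) +
        ∑ i, ∑ j, l j * (w i j * (l j - l i)) := by
      simp only [hS, ← sum_add_distrib]
      exact sum_congr rfl fun i _ => sum_congr rfl fun j _ => by ring
    have e2 : ∑ i, ∑ j, l j * (w i j * (l j - l i)) =
        ∑ i, ∑ j, l i * (w i j * (l i - l j)) := by
      rw [sum_comm]
      exact sum_congr rfl fun i _ => sum_congr rfl fun j _ => by rw [hs]
    rw [e1, e2, ← two_mul]; simp only [mul_sum]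
  have hcs2 := sum_mul_sq_le_sq_mul_sq univ l (fun i => ∑ j, w i j * (l i - l j))
  have hfin : S * S ≤ ((∑ i, l i ^ 2) * (K + 1)) * S := by
    have h1 : S * S ≤ (∑ i, l i ^ 2) * (4 * ∑ i, (∑ j, w i j * (l i - l j)) ^ 2) := by
      nlinarith
    have h2 : 4 * ∑ i, (∑ j, w i j * (l i - l j)) ^ 2 ≤ (K + 1) * S := by linarith
    calc S * S ≤ _ := h1
      _ ≤ (∑ i, l i ^ 2) * ((K + 1) * S) := mul_le_mul_of_nonneg_left h2 hL0
      _ = _ := by ring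
  rcases hS0.eq_or_lt with h | h
  · rw [← h]; positivity
  · exact le_of_mul_le_mul_right hfin h

/-- Bessel's inequality for the off-diagonal entries of orthogonal symmetric matrices. -/
lemma two_mul_sum_entry_sq_le_one (B : κ → Matrix ι ι ℝ) (T : Finset κ)
    (hsym : ∀ b, (B b).IsSymm)
    (horth : ∀ b c, b ≠ c → ∑ i, ∑ j, B b i j * B c i j = 0)
    (hnorm : ∀ b, frobSq (B b) ≤ 1) {i j : ι} (hij : i ≠ j) :
    2 * ∑ b ∈ T, B b i j ^ 2 ≤ 1 := by
  classical
  set w := ∑ b ∈ T, B b i j ^ 2 with hw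
  have hw0 : 0 ≤ w := sum_nonneg fun _ _ => sq_nonneg _
  let P : ι → ι → ℝ := fun k l => ∑ b ∈ T, B b i j * B b k l
  have hPij : P i j = w := sum_congr rfl fun b _ => by rw [sq]
  have hPji : P j i = w := sum_congr rfl fun b _ => by rw [(hsym b).apply i j, sq]
  have hup : ∑ k, ∑ l, P k l ^ 2 ≤ w := by
    have e : ∑ k, ∑ l, P k l ^ 2 = ∑ b ∈ T, B b i j ^ 2 * frobSq (B b) := by
      have e1 : ∀ k l, P k l ^ 2 =
          ∑ b ∈ T, ∑ c ∈ T, B b i j * B c i j * (B b k l * B c k l) := by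
        intro k l
        simp only [P, sq, sum_mul_sum]
        exact sum_congr rfl fun b _ => sum_congr rfl fun c _ => by ring
      simp only [e1]
      calc _ = ∑ b ∈ T, ∑ c ∈ T, B b i j * B c i j * ∑ k, ∑ l, B b k l * B c k l := by
            simp only [mul_sum]
            simp_rw [sum_comm (s := (univ : Finset ι)) (t := T)]
        _ = _ := by
            refine sum_congr rfl fun b hb => ?_
            rw [sum_eq_single_of_mem b hb
              (fun c _ hc => by rw [horth b c (Ne.symm hc), mul_zero])]
            simp only [frobSq, sq]
    rw [e]
    refine sum_le_sum fun b _ => ?_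
    nlinarith [hnorm b, sq_nonneg (B b i j)]
  have hlow : 2 * w ^ 2 ≤ ∑ k, ∑ l, P k l ^ 2 := by
    have hnn : ∀ k, 0 ≤ ∑ l, P k l ^ 2 := fun k => sum_nonneg fun _ _ => sq_nonneg _
    have h1 : ∑ k ∈ {i, j}, ∑ l, P k l ^ 2 ≤ ∑ k, ∑ l, P k l ^ 2 :=
      sum_le_sum_of_subset_of_nonneg (subset_univ _) fun k _ _ => hnn k
    rw [sum_pair hij] at h1
    have h2 : P i j ^ 2 ≤ ∑ l, P i l ^ 2 :=
      single_le_sum (f := fun l => P i l ^ 2) (fun _ _ => sq_nonneg _) (mem_univ j)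
    have h3 : P j i ^ 2 ≤ ∑ l, P j l ^ 2 :=
      single_le_sum (f := fun l => P j l ^ 2) (fun _ _ => sq_nonneg _) (mem_univ i)
    rw [hPij] at h2; rw [hPji] at h3
    linarith
  by_contra hcon
  nlinarith

/-- The commutator estimate for a diagonal matrix. -/
lemma sum_frobSq_commutator_diagonal_le [DecidableEq ι] (d : ι → ℝ) (B : κ → Matrix ι ι ℝ)
    (T : Finset κ) (hsym : ∀ b, (B b).IsSymm)
    (horth : ∀ b c, b ≠ c → ∑ i, ∑ j, B b i j * B c i j = 0)
    (hnorm : ∀ b, frobSq (B b) ≤ 1) :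
    ∑ b ∈ T, frobSq (diagonal d * B b - B b * diagonal d) ≤
      frobSq (diagonal d) * (T.card + 1) := by
  have hd : frobSq (diagonal d) = ∑ i, d i ^ 2 := by
    simp [frobSq, diagonal_apply, ite_pow]
  have hc : ∑ b ∈ T, frobSq (diagonal d * B b - B b * diagonal d) =
      ∑ i, ∑ j, (∑ b ∈ T, B b i j ^ 2) * (d i - d j) ^ 2 := by
    simp only [frobSq, Matrix.sub_apply, diagonal_mul, mul_diagonal, sum_mul]
    rw [sum_comm]
    refine sum_congr rfl fun i _ => ?_
    rw [sum_comm]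
    exact sum_congr rfl fun j _ => sum_congr rfl fun b _ => by ring
  rw [hd, hc]
  refine sum_weight_mul_sub_sq_le _ d _ (fun i j => sum_nonneg fun _ _ => sq_nonneg _)
    (fun i j => sum_congr rfl fun b _ => by rw [(hsym b).apply i j])
    (fun i j hij => two_mul_sum_entry_sq_le_one B T hsym horth hnorm hij) ?_
  have e : ∑ i, ∑ j, ∑ b ∈ T, B b i j ^ 2 = ∑ b ∈ T, frobSq (B b) := by
    simp only [frobSq]
    simp_rw [sum_comm (s := (univ : Finset ι)) (t := T)]
  rw [e]
  simpa using sum_le_sum fun b (_ : b ∈ T) => hnorm b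

lemma sum_entry_mul_eq_trace (M N : Matrix ι ι ℝ) :
    ∑ i, ∑ j, M i j * N i j = (M * Nᵀ).trace := by
  simp [Matrix.trace, Matrix.mul_apply]

/-- For symmetric `A` and pairwise orthogonal symmetric `B b` of norm at most one, the sum of the
squared norms of `k` commutators `[A, B b]` is at most `(k + 1) ‖A‖²`. -/
lemma sum_frobSq_commutator_le [DecidableEq ι] (A : Matrix ι ι ℝ) (hA : A.IsSymm)
    (B : κ → Matrix ι ι ℝ) (T : Finset κ) (hsym : ∀ b, (B b).IsSymm)
    (horth : ∀ b c, b ≠ c → ∑ i, ∑ j, B b i j * B c i j = 0)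
    (hnorm : ∀ b, frobSq (B b) ≤ 1) :
    ∑ b ∈ T, frobSq (A * B b - B b * A) ≤ frobSq A * (T.card + 1) := by
  obtain ⟨O, d, hO, hd⟩ := exists_orthogonal_conj_eq_diagonal A hA
  have hmul : ∀ M N : Matrix ι ι ℝ, O * (M * N) * Oᵀ = O * M * Oᵀ * (O * N * Oᵀ) := by
    intro M N
    calc O * (M * N) * Oᵀ = O * M * 1 * N * Oᵀ := by
          simp only [Matrix.mul_one, Matrix.mul_assoc]
      _ = _ := by rw [← hO]; simp only [Matrix.mul_assoc]
  have hkey := sum_frobSq_commutator_diagonal_le d (fun b => O * B b * Oᵀ) T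
    (fun b => by
      simp [Matrix.IsSymm, Matrix.transpose_mul, (hsym b).eq, Matrix.mul_assoc])
    (fun b c hbc => by
      rw [sum_entry_mul_eq_trace]
      have h1 : (O * B c * Oᵀ)ᵀ = O * (B c)ᵀ * Oᵀ := by
        simp [Matrix.transpose_mul, Matrix.mul_assoc]
      rw [h1, ← hmul, Matrix.trace_mul_comm, ← Matrix.mul_assoc, hO, Matrix.one_mul,
        ← sum_entry_mul_eq_trace, horth b c hbc])
    (fun b => by rw [frobSq_conj O _ hO]; exact hnorm b)
  rw [← hd, frobSq_conj O _ hO] at hkey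
  refine le_trans (le_of_eq (sum_congr rfl fun b _ => ?_)) hkey
  rw [← frobSq_conj O (A * B b - B b * A) hO, ← hmul, ← hmul, Matrix.mul_sub, Matrix.sub_mul]

/-- A symmetric quadratic form all of whose principal submatrices have nonnegative row sums is
nonnegative on nonnegative vectors. -/
lemma sum_mul_mul_nonneg_of_row_sums_nonneg (d : κ → κ → ℝ) (hs : ∀ a b, d a b = d b a)
    (hd : ∀ T : Finset κ, ∀ a ∈ T, 0 ≤ ∑ b ∈ T, d a b) (T : Finset κ) (x : κ → ℝ)
    (hx : ∀ a ∈ T, 0 ≤ x a) : 0 ≤ ∑ a ∈ T, ∑ b ∈ T, x a * x b * d a b := by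
  classical
  induction T using Finset.strongInduction generalizing x with
  | H T ih =>
  rcases T.eq_empty_or_nonempty with rfl | hne
  · simp
  obtain ⟨a₀, ha₀, hmin⟩ := exists_min_image T x hne
  set t := x a₀
  have ht : 0 ≤ t := hx a₀ ha₀
  have hy : ∀ a ∈ T, 0 ≤ x a - t := fun a ha => sub_nonneg.2 (hmin a ha)
  have hrec := ih (T.erase a₀) (erase_ssubset ha₀) (fun a => x a - t)
    fun a ha => hy a (mem_of_mem_erase ha)
  have hext : ∑ a ∈ T.erase a₀, ∑ b ∈ T.erase a₀, (x a - t) * (x b - t) * d a b =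
      ∑ a ∈ T, ∑ b ∈ T, (x a - t) * (x b - t) * d a b := by
    rw [← sum_erase T (a := a₀) (by simp [t])]
    exact sum_congr rfl fun a _ => sum_erase T (by simp [t])
  have hlin : 0 ≤ ∑ a ∈ T, (x a - t) * ∑ b ∈ T, d a b :=
    sum_nonneg fun a ha => mul_nonneg (hy a ha) (hd T a ha)
  have hconst : 0 ≤ ∑ a ∈ T, ∑ b ∈ T, d a b := sum_nonneg fun a ha => hd T a ha
  have hswap : ∑ a ∈ T, ∑ b ∈ T, (x b - t) * d a b = ∑ a ∈ T, (x a - t) * ∑ b ∈ T, d a b := by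
    rw [sum_comm]
    refine sum_congr rfl fun a _ => ?_
    rw [mul_sum]
    exact sum_congr rfl fun b _ => by rw [hs]
  have hsplit : ∑ a ∈ T, ∑ b ∈ T, x a * x b * d a b =
      ∑ a ∈ T, ∑ b ∈ T, (x a - t) * (x b - t) * d a b +
      t * ∑ a ∈ T, (x a - t) * ∑ b ∈ T, d a b +
      t * ∑ a ∈ T, ∑ b ∈ T, (x b - t) * d a b + t ^ 2 * ∑ a ∈ T, ∑ b ∈ T, d a b := by
    simp only [mul_sum, ← sum_add_distrib]
    exact sum_congr rfl fun a _ => sum_congr rfl fun b _ => by ring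
  rw [hsplit, hswap, ← hext]
  positivity

/-- The DDVV inequality for pairwise orthogonal symmetric matrices. -/
lemma sum_frobSq_commutator_le_sq_of_orthogonal [DecidableEq ι] [Fintype κ]
    (A : κ → Matrix ι ι ℝ) (hsym : ∀ r, (A r).IsSymm)
    (horth : ∀ r s, r ≠ s → ∑ i, ∑ j, A r i j * A s i j = 0) :
    ∑ r, ∑ s, frobSq (A r * A s - A s * A r) ≤ (∑ r, frobSq (A r)) ^ 2 := by
  classical
  let x : κ → ℝ := fun r => frobSq (A r)
  have hx : ∀ r, 0 ≤ x r := fun r => frobSq_nonneg _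
  let B : κ → Matrix ι ι ℝ := fun r => (√(x r))⁻¹ • A r
  have hAB : ∀ r, A r = √(x r) • B r := by
    intro r
    by_cases h0 : x r = 0
    · have hz : ∀ i j, A r i j = 0 := by
        intro i j
        have h1 := (sum_eq_zero_iff_of_nonneg
          (fun i _ => sum_nonneg fun j _ => sq_nonneg (A r i j))).1 h0 i (mem_univ i)
        have h2 := (sum_eq_zero_iff_of_nonneg (fun j _ => sq_nonneg (A r i j))).1 h1 j
          (mem_univ j)
        exact pow_eq_zero_iff (two_ne_zero) |>.1 h2
      ext i j
      simp [B, hz]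
    · have : √(x r) ≠ 0 := (Real.sqrt_pos.2 (lt_of_le_of_ne (hx r) (Ne.symm h0))).ne'
      simp only [B, smul_smul, mul_inv_cancel₀ this, one_smul]
  have hBnorm : ∀ r, frobSq (B r) ≤ 1 := by
    intro r
    simp only [B, frobSq_smul, inv_pow, Real.sq_sqrt (hx r)]
    exact inv_mul_le_one
  have hBsym : ∀ r, (B r).IsSymm := fun r => (hsym r).smul _
  have hBorth : ∀ r s, r ≠ s → ∑ i, ∑ j, B r i j * B s i j = 0 := by
    intro r s hrs
    have : ∑ i, ∑ j, B r i j * B s i j =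
        ((√(x r))⁻¹ * (√(x s))⁻¹) * ∑ i, ∑ j, A r i j * A s i j := by
      simp only [B, Matrix.smul_apply, smul_eq_mul, mul_sum]
      exact sum_congr rfl fun i _ => sum_congr rfl fun j _ => by ring
    rw [this, horth r s hrs, mul_zero]
  let c : κ → κ → ℝ := fun r s => frobSq (B r * B s - B s * B r)
  have hcs : ∀ r s, c r s = c s r := by
    intro r s
    have : B s * B r - B r * B s = (-1 : ℝ) • (B r * B s - B s * B r) := by simp
    simp only [c]
    rw [this, frobSq_smul]; norm_num
  have hrow : ∀ T : Finset κ, ∀ a ∈ T, 0 ≤ ∑ b ∈ T, (1 - c a b) := by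
    intro T a ha
    have hcaa : c a a = 0 := by simp [c, frobSq]
    have hle := sum_frobSq_commutator_le (B a) (hBsym a) B (T.erase a) hBsym hBorth hBnorm
    have hcard : ((T.erase a).card : ℝ) + 1 = T.card := by
      exact_mod_cast card_erase_add_one ha
    rw [hcard] at hle
    have hsum : ∑ b ∈ T.erase a, c a b = ∑ b ∈ T, c a b := sum_erase T hcaa
    have : ∑ b ∈ T, c a b ≤ T.card := by
      rw [← hsum]
      refine hle.trans ?_
      exact mul_le_of_le_one_left (Nat.cast_nonneg _) (hBnorm a)
    simp only [sum_sub_distrib, sum_const, nsmul_eq_mul, mul_one]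
    linarith
  have hmain := sum_mul_mul_nonneg_of_row_sums_nonneg (fun a b => 1 - c a b)
    (fun a b => by simp only [hcs a b]) hrow univ x fun a _ => hx a
  have hcomm : ∀ r s, frobSq (A r * A s - A s * A r) = x r * x s * c r s := by
    intro r s
    have : A r * A s - A s * A r = (√(x r) * √(x s)) • (B r * B s - B s * B r) := by
      conv_lhs => rw [hAB r, hAB s]
      simp only [Matrix.smul_mul, Matrix.mul_smul, smul_smul, smul_sub, mul_comm (√(x s))]
    rw [this, frobSq_smul, mul_pow, Real.sq_sqrt (hx r), Real.sq_sqrt (hx s)]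
  have hsq : (∑ r, frobSq (A r)) ^ 2 = ∑ r, ∑ s, x r * x s := by
    rw [sq, sum_mul_sum]
  rw [hsq]
  simp only [hcomm]
  have : ∑ r, ∑ s, x r * x s * (1 - c r s) =
      ∑ r, ∑ s, x r * x s - ∑ r, ∑ s, x r * x s * c r s := by
    simp only [mul_sub, mul_one, sum_sub_distrib]
  linarith

lemma sum_frobSq_orthogonal_combination [Fintype κ] [DecidableEq κ] (O : Matrix κ κ ℝ)
    (hO : Oᵀ * O = 1) (M : κ → Matrix ι ι ℝ) :
    ∑ r, frobSq (∑ s, O r s • M s) = ∑ r, frobSq (M r) := by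
  have hvec : ∀ v : κ → ℝ, ∑ r, (∑ s, O r s * v s) ^ 2 = ∑ r, v r ^ 2 := by
    intro v
    have h1 : (O *ᵥ v) ⬝ᵥ (O *ᵥ v) = v ⬝ᵥ v := by
      rw [Matrix.dotProduct_mulVec, Matrix.vecMul_mulVec, hO, Matrix.vecMul_one]
    simpa [dotProduct, mulVec, sq] using h1
  have hswap : ∀ N : κ → Matrix ι ι ℝ,
      ∑ r, frobSq (N r) = ∑ i, ∑ j, ∑ r, N r i j ^ 2 := by
    intro N
    simp only [frobSq]
    rw [sum_comm]
    exact sum_congr rfl fun i _ => sum_comm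
  rw [hswap, hswap]
  refine sum_congr rfl fun i _ => sum_congr rfl fun j _ => ?_
  simpa [Matrix.sum_apply] using hvec fun s => M s i j

/-- The DDVV inequality: `∑ r s, ‖[A r, A s]‖² ≤ (∑ r, ‖A r‖²)²` for real symmetric matrices. -/
theorem sum_frobSq_commutator_le_sq [DecidableEq ι] [Fintype κ] (A : κ → Matrix ι ι ℝ)
    (hsym : ∀ r, (A r).IsSymm) :
    ∑ r, ∑ s, frobSq (A r * A s - A s * A r) ≤ (∑ r, frobSq (A r)) ^ 2 := by
  classical
  let G : Matrix κ κ ℝ := Matrix.of fun r s => ∑ i, ∑ j, A r i j * A s i j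
  have hG : G.IsSymm := by
    ext r s
    simp only [G, Matrix.transpose_apply, Matrix.of_apply, mul_comm]
  obtain ⟨O, d, hO, hd⟩ := exists_orthogonal_conj_eq_diagonal G hG
  let A' : κ → Matrix ι ι ℝ := fun r => ∑ s, O r s • A s
  have horth : ∀ r s, r ≠ s → ∑ i, ∑ j, A' r i j * A' s i j = 0 := by
    intro r s hrs
    have h1 : (O * G * Oᵀ) r s = 0 := by rw [hd, diagonal_apply_ne _ hrs]
    rw [← h1]
    simp only [A', Matrix.mul_apply, Matrix.transpose_apply, Matrix.sum_apply,
      Matrix.smul_apply, smul_eq_mul, G, Matrix.of_apply, mul_sum, sum_mul]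
    simp_rw [sum_comm (s := (univ : Finset ι)) (t := (univ : Finset κ))]
    exact sum_congr rfl fun a _ => sum_congr rfl fun b _ => sum_congr rfl fun i _ =>
      sum_congr rfl fun j _ => by ring
  have hkey := sum_frobSq_commutator_le_sq_of_orthogonal A'
    (fun r => by
      simp only [Matrix.IsSymm, A', Matrix.transpose_sum, Matrix.transpose_smul, (hsym _).eq])
    horth
  have hright : ∀ (r : κ) (X : Matrix ι ι ℝ),
      A' r * X - X * A' r = ∑ s, O r s • (A s * X - X * A s) := by
    intro r X
    simp only [A', Matrix.sum_mul, Matrix.mul_sum, Matrix.smul_mul, Matrix.mul_smul, smul_sub,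
      sum_sub_distrib]
  have hleft : ∀ (r : κ) (X : Matrix ι ι ℝ),
      X * A' r - A' r * X = ∑ s, O r s • (X * A s - A s * X) := by
    intro r X
    simp only [A', Matrix.sum_mul, Matrix.mul_sum, Matrix.smul_mul, Matrix.mul_smul, smul_sub,
      sum_sub_distrib]
  have hlhs : ∑ r, ∑ s, frobSq (A' r * A' s - A' s * A' r) =
      ∑ r, ∑ s, frobSq (A r * A s - A s * A r) := by
    calc _ = ∑ r, ∑ s, frobSq (A' r * A s - A s * A' r) := by
          refine sum_congr rfl fun r _ => ?_
          simp only [hleft _ (A' r)]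
          exact sum_frobSq_orthogonal_combination O hO fun s => A' r * A s - A s * A' r
      _ = ∑ s, ∑ r, frobSq (A' r * A s - A s * A' r) := sum_comm
      _ = ∑ s, ∑ r, frobSq (A r * A s - A s * A r) := by
          refine sum_congr rfl fun s _ => ?_
          simp only [hright _ (A s)]
          exact sum_frobSq_orthogonal_combination O hO fun r => A r * A s - A s * A r
      _ = _ := sum_comm
  rwa [hlhs, sum_frobSq_orthogonal_combination O hO A] at hkey

end DDVV

/-- Sum of a symmetric function over pairs `i < j`. -/
lemma two_mul_sum_lt {k : ℕ} (f : Fin k → Fin k → ℝ) (hf : ∀ i j, f i j = f j i) :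
    2 * ∑ i, ∑ j, (if i < j then f i j else 0) = ∑ i, ∑ j, f i j - ∑ i, f i i := by
  have h1 : ∑ i, ∑ j, (if i < j then f i j else 0) =
      ∑ i, ∑ j, (if j < i then f i j else 0) := by
    rw [sum_comm]
    exact sum_congr rfl fun i _ => sum_congr rfl fun j _ => by rw [hf]
  have h2 : ∑ i, f i i = ∑ i, ∑ j, (if i = j then f i j else 0) := by simp
  rw [two_mul]
  nth_rewrite 2 [h1]
  rw [h2]
  simp only [← sum_add_distrib, ← sum_sub_distrib]
  refine sum_congr rfl fun i _ => sum_congr rfl fun j _ => ?_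
  rcases lt_trichotomy i j with hij | hij | hij
  · simp [hij, hij.ne, hij.not_gt]
  · simp [hij]
  · simp [hij, hij.ne', hij.not_gt]

/-- The traceless part of a matrix. -/
noncomputable def tracelessPart {n : ℕ} (M : Matrix (Fin n) (Fin n) ℝ) :
    Matrix (Fin n) (Fin n) ℝ :=
  M - (M.trace / n) • (1 : Matrix (Fin n) (Fin n) ℝ)

lemma frobSq_tracelessPart {n : ℕ} (hn : (n : ℝ) ≠ 0) (M : Matrix (Fin n) (Fin n) ℝ) :
    frobSq (tracelessPart M) = frobSq M - M.trace ^ 2 / n := by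
  have hpt : ∀ i j, tracelessPart M i j ^ 2 = M i j ^ 2 +
      (if i = j then -2 * (M.trace / n) * M i j + (M.trace / n) ^ 2 else 0) := by
    intro i j
    by_cases hij : i = j
    · subst hij; simp [tracelessPart]; ring
    · simp [tracelessPart, hij]
  have ht : ∑ i, M i i = M.trace := rfl
  simp only [frobSq, hpt, sum_add_distrib, sum_ite_eq, mem_univ, if_true, ← mul_sum, ht,
    sum_const, card_univ, Fintype.card_fin, nsmul_eq_mul]
  field_simp
  ring

lemma commutator_tracelessPart {n : ℕ} (M N : Matrix (Fin n) (Fin n) ℝ) :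
    tracelessPart M * tracelessPart N - tracelessPart N * tracelessPart M = M * N - N * M := by
  simp only [tracelessPart, Matrix.sub_mul, Matrix.mul_sub, Matrix.smul_mul, Matrix.mul_smul,
    Matrix.one_mul, Matrix.mul_one, smul_sub, smul_smul, mul_comm (N.trace / n)]
  abel

/-- The normal curvature sum over `i < j`, `r < s` is a quarter of the full sum of squared
commutator norms. -/
lemma four_mul_sum_normal_curvature {n k : ℕ} (h : Fin k → Matrix (Fin n) (Fin n) ℝ)
    (hsymm : ∀ r, (h r).IsSymm) (Rp : Fin n → Fin n → Fin k → Fin k → ℝ)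
    (ricci : ∀ i j r s, Rp i j r s = (h r * h s - h s * h r) j i) :
    4 * ∑ i, ∑ j, ∑ r, ∑ s, (if i < j ∧ r < s then Rp i j r s ^ 2 else 0) =
      ∑ r, ∑ s, frobSq (h r * h s - h s * h r) := by
  have hanti : ∀ i j r s, Rp i j r s = - Rp j i r s := by
    intro i j r s
    rw [ricci, ricci]
    have : (h r * h s - h s * h r)ᵀ = -(h r * h s - h s * h r) := by
      rw [Matrix.transpose_sub, Matrix.transpose_mul, Matrix.transpose_mul, (hsymm r).eq,
        (hsymm s).eq, neg_sub]
    exact congrFun (congrFun this i) j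
  have hanti' : ∀ i j r s, Rp i j r s = - Rp i j s r := by
    intro i j r s
    rw [ricci, ricci, ← Matrix.neg_apply, neg_sub]
  have hrs : ∀ i j, 2 * ∑ r, ∑ s, (if r < s then Rp i j r s ^ 2 else 0) =
      ∑ r, ∑ s, Rp i j r s ^ 2 := by
    intro i j
    rw [two_mul_sum_lt (fun r s => Rp i j r s ^ 2) fun r s => by rw [hanti', neg_sq]]
    simp [ricci]
  have hij := two_mul_sum_lt (fun i j => ∑ r, ∑ s, Rp i j r s ^ 2) fun i j =>
    sum_congr rfl fun r _ => sum_congr rfl fun s _ => by rw [hanti, neg_sq]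
  have hdiag : ∀ i r s, Rp i i r s = 0 := fun i r s => by linarith [hanti i i r s]
  simp only [hdiag, ne_eq, OfNat.ofNat_ne_zero, not_false_eq_true, zero_pow, sum_const_zero,
    sub_zero] at hij
  have hfull : ∑ i, ∑ j, ∑ r, ∑ s, Rp i j r s ^ 2 =
      ∑ r, ∑ s, frobSq (h r * h s - h s * h r) := by
    simp only [frobSq, ← ricci]
    simp_rw [sum_comm (s := (univ : Finset (Fin n))) (t := (univ : Finset (Fin k)))]
    exact sum_congr rfl fun r _ => sum_congr rfl fun s _ => sum_comm
  rw [← hfull, ← hij, show (4 : ℝ) = 2 * 2 by norm_num, mul_assoc]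
  congr 1
  rw [mul_sum]
  refine sum_congr rfl fun i _ => ?_
  rw [mul_sum]
  refine sum_congr rfl fun j _ => ?_
  by_cases h1 : i < j
  · simp only [h1, true_and, if_true, hrs]
  · simp [h1]

/-- Twice the scalar curvature from the Gauss equation. -/
lemma two_mul_scalarCurv {n m : ℕ} (hnm : n ≤ m)
    (Rt : Fin m → Fin m → Fin m → Fin m → ℝ)
    (R : Fin n → Fin n → Fin n → Fin n → ℝ)
    (h : Fin (m - n) → Matrix (Fin n) (Fin n) ℝ)
    (hsymm : ∀ r, (h r).IsSymm) (p q : ℝ) (ψ : Fin m → ℝ)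
    (quasi : ∀ x y z w : Fin m, Rt x y z w =
      p * (kdelta y z * kdelta x w - kdelta x z * kdelta y w)
      + q * (kdelta x w * ψ y * ψ z - kdelta x z * ψ y * ψ w
          + kdelta y z * ψ x * ψ w - kdelta y w * ψ x * ψ z))
    (gauss : ∀ i j k l : Fin n, R i j k l =
      Rt (Fin.castLE hnm i) (Fin.castLE hnm j) (Fin.castLE hnm k) (Fin.castLE hnm l)
      + ∑ r : Fin (m - n), (h r i l * h r j k - h r i k * h r j l)) :
    2 * scalarCurv R = n * (n - 1) * p +
      2 * (n - 1) * q * ∑ j : Fin n, ψ (Fin.castLE hnm j) ^ 2 +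
      ∑ r, ((h r).trace ^ 2 - frobSq (h r)) := by
  have hR : ∀ i j, i < j → R i j j i = p +
      q * (ψ (Fin.castLE hnm i) ^ 2 + ψ (Fin.castLE hnm j) ^ 2) +
      ∑ r, (h r i i * h r j j - h r i j ^ 2) := by
    intro i j hij
    have hne : Fin.castLE hnm i ≠ Fin.castLE hnm j := fun he =>
      hij.ne (Fin.castLE_injective hnm he)
    have hsum : ∑ r, (h r i i * h r j j - h r i j * h r j i) =
        ∑ r, (h r i i * h r j j - h r i j ^ 2) :=
      sum_congr rfl fun r _ => by rw [(hsymm r).apply i j, sq]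
    rw [gauss, quasi, hsum]
    simp only [kdelta, hne, hne.symm, if_true, if_false]
    ring
  let F : Fin n → Fin n → ℝ := fun i j => p +
      q * (ψ (Fin.castLE hnm i) ^ 2 + ψ (Fin.castLE hnm j) ^ 2) +
      ∑ r, (h r i i * h r j j - h r i j ^ 2)
  have hsc : scalarCurv R = ∑ i, ∑ j, (if i < j then F i j else 0) := by
    refine sum_congr rfl fun i _ => sum_congr rfl fun j _ => ?_
    split_ifs with hij
    · exact hR i j hij
    · rfl
  have hF : ∀ i j, F i j = F j i := by
    intro i j
    simp only [F]
    rw [add_comm (ψ (Fin.castLE hnm i) ^ 2)]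
    congr 1
    exact sum_congr rfl fun r _ => by rw [(hsymm r).apply i j, mul_comm]
  rw [hsc, two_mul_sum_lt F hF]
  have hdiag : ∑ i, F i i = n * p + 2 * q * ∑ j : Fin n, ψ (Fin.castLE hnm j) ^ 2 := by
    have : ∀ i, F i i = p + 2 * q * ψ (Fin.castLE hnm i) ^ 2 := by
      intro i
      simp only [F, ← sq, sub_self, sum_const_zero]; ring
    simp [this, sum_add_distrib, mul_sum]
  have hgauss : ∑ i, ∑ j, ∑ r, (h r i i * h r j j - h r i j ^ 2) =
      ∑ r, ((h r).trace ^ 2 - frobSq (h r)) := by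
    have : ∀ r, (h r).trace ^ 2 - frobSq (h r) =
        ∑ i, ∑ j, (h r i i * h r j j - h r i j ^ 2) := by
      intro r
      simp only [frobSq, Matrix.trace, Matrix.diag, sq (∑ i, h r i i), sum_mul_sum,
        sum_sub_distrib]
    simp only [this]
    simp_rw [sum_comm (s := (univ : Finset (Fin n))) (t := (univ : Finset (Fin (m - n))))]
  have hall : ∑ i, ∑ j, F i j = n * n * p +
      2 * n * q * ∑ j : Fin n, ψ (Fin.castLE hnm j) ^ 2 +
      ∑ r, ((h r).trace ^ 2 - frobSq (h r)) := by
    rw [← hgauss]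
    simp only [F, sum_add_distrib, ← mul_sum, sum_const, card_univ, Fintype.card_fin,
      nsmul_eq_mul]
    ring
  rw [hall, hdiag]
  ring

/-- **Generalized Wintgen inequality in a manifold of quasi-constant curvature
(`ρ^⊥` version).**  With the quasi-constant ambient curvature (hypothesis `quasi`), the
Gauss equation (`gauss`) and the Ricci equation (`ricci`),
`ρ + ρ^⊥ ≤ ‖H‖² + p + (2q/n) ‖V^T‖²`. -/
theorem wintgen_rhoPerp_quasi_constant {n m : ℕ} (hn : 3 ≤ n) (hm : 4 ≤ m) (hnm : n ≤ m)
    (Rt : Fin m → Fin m → Fin m → Fin m → ℝ)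
    (R : Fin n → Fin n → Fin n → Fin n → ℝ)
    (h : Fin (m - n) → Matrix (Fin n) (Fin n) ℝ)
    (hsymm : ∀ r, (h r).IsSymm)
    (p q : ℝ) (ψ : Fin m → ℝ) (hψ : ∑ x : Fin m, ψ x ^ 2 = 1)
    (Rperp : Fin n → Fin n → Fin (m - n) → Fin (m - n) → ℝ)
    (ricci : ∀ (i j : Fin n) (r s : Fin (m - n)),
      Rperp i j r s = (h r * h s - h s * h r) j i)
    (quasi : ∀ x y z w : Fin m, Rt x y z w =
      p * (kdelta y z * kdelta x w - kdelta x z * kdelta y w)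
      + q * (kdelta x w * ψ y * ψ z - kdelta x z * ψ y * ψ w
          + kdelta y z * ψ x * ψ w - kdelta y w * ψ x * ψ z))
    (gauss : ∀ i j k l : Fin n, R i j k l =
      Rt (Fin.castLE hnm i) (Fin.castLE hnm j) (Fin.castLE hnm k) (Fin.castLE hnm l)
      + ∑ r : Fin (m - n), (h r i l * h r j k - h r i k * h r j l)) :
    normScalarCurv R + rhoPerp Rperp ≤
      meanCurvSq h + p + 2 * q / (n : ℝ) * ∑ j : Fin n, ψ (Fin.castLE hnm j) ^ 2 := by
  have hn3 : (3 : ℝ) ≤ n := by exact_mod_cast hn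
  have hn0 : (n : ℝ) ≠ 0 := by linarith
  have hn1 : (n : ℝ) - 1 ≠ 0 := by linarith
  have hpos : 0 < (n : ℝ) * ((n : ℝ) - 1) := mul_pos (by linarith) (by linarith)
  have hsc := two_mul_scalarCurv hnm Rt R h hsymm p q ψ quasi gauss
  have hKN := four_mul_sum_normal_curvature h hsymm Rperp ricci
  have hddvv := sum_frobSq_commutator_le_sq (fun r => tracelessPart (h r)) fun r => by
    simp [tracelessPart, Matrix.IsSymm, Matrix.transpose_sub, (hsymm r).eq]
  simp only [commutator_tracelessPart, frobSq_tracelessPart hn0] at hddvv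
  have hnn : 0 ≤ ∑ r, (frobSq (h r) - (h r).trace ^ 2 / n) :=
    sum_nonneg fun r _ => by rw [← frobSq_tracelessPart hn0]; exact frobSq_nonneg _
  have hsqrt : 2 * Real.sqrt (∑ i : Fin n, ∑ j : Fin n, ∑ r : Fin (m - n), ∑ s : Fin (m - n),
      if i < j ∧ r < s then Rperp i j r s ^ 2 else 0) ≤
      ∑ r, (frobSq (h r) - (h r).trace ^ 2 / n) := by
    rw [← le_div_iff₀' two_pos]
    refine Real.sqrt_le_iff.2 ⟨by positivity, ?_⟩
    rw [div_pow]
    linarith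
  have hH : meanCurvSq h = (∑ r, (h r).trace ^ 2) / (n : ℝ) ^ 2 := by
    simp only [meanCurvSq, Matrix.trace, Matrix.diag, sum_div]
    exact sum_congr rfl fun r _ => by ring
  rw [sum_sub_distrib] at hsc hsqrt
  rw [← sum_div] at hsqrt
  rw [normScalarCurv, rhoPerp, hsc, hH, div_mul_eq_mul_div, ← add_div, div_le_iff₀ hpos]
  refine (add_le_add_right hsqrt _).trans (le_of_eq ?_)
  field_simp
  ring
end
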